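/- arXiv:2308.16539 — 2 statements merged into one kernel-verified Lean document; each statement's English description precedes it below -/
import Mathlib

section
/- Consider N players over the time horizon [0, T] with T > 0. For each player i let U_i be its control-value set, E_i = ℝ^{n_i} its state space, and let ξ_i map each open-loop strategy u_i : [0, T] → U_i to a state trajectory ξ_i(u_i) : [0, T] → E_i (decoupled dynamics: player i's trajectory depends only on its own strategy). For a joint strategy u = (u_1, …, u_N), write x_u(t) = (ξ_1(u_1)(t), …, ξ_N(u_N)(t)). Suppose each player's cost is C_i(u) = ∫_0^T L_i(x_u(t), u(t), t) dt + S_i(x_u(T)), where L_i(x, w, t) = p(x, w, t) + c_i(x, w, t) with c_i independent of the i-th components of x and w (c_i(x, w, t) = c_i(x', w', t) whenever x_j = x'_j and w_j = w'_j for all j ≠ i), and S_i(x) = s̄(x) + s_i(x) with s_i independent of the i-th component of x. Assume that for every joint strategy u the functions t ↦ p(x_u(t), u(t), t) and t ↦ c_i(x_u(t), u(t), t) (for each i) are integrable on [0, T]. If u* minimizes the potential cost J(u) = ∫_0^T p(x_u(t), u(t), t) dt + s̄(x_u(T)) over all joint strategies, then u* is an open-loop Nash equilibrium: for every player i and every strategy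 u_i : [0, T] → U_i, C_i(u*) ≤ C_i(u*[i ↦ u_i]). -/
open MeasureTheory

/-- Potential differential game (open-loop, decoupled dynamics): if the running
costs are `pₜ + cᵢ` with `cᵢ` independent of player `i`'s own state and control,
and the terminal costs are `s̄ + sᵢ` with `sᵢ` independent of player `i`'s own
state, then any minimizer of the potential optimal control cost
`J(u) = ∫₀ᵀ p dt + s̄(x(T))` is an open-loop Nash equilibrium. -/
theorem potential_ocp_minimizer_is_open_loop_nash
    {N : ℕ} (T : ℝ) (hT : 0 < T)
    (U : Fin N → Type*) (n : Fin N → ℕ)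
    (ξ : ∀ i : Fin N, (ℝ → U i) → ℝ → (Fin (n i) → ℝ))
    (p : (∀ j, Fin (n j) → ℝ) → (∀ j, U j) → ℝ → ℝ)
    (c : ∀ _ : Fin N, (∀ j, Fin (n j) → ℝ) → (∀ j, U j) → ℝ → ℝ)
    (sbar : (∀ j, Fin (n j) → ℝ) → ℝ)
    (s : ∀ _ : Fin N, (∀ j, Fin (n j) → ℝ) → ℝ)
    (hc_indep : ∀ (i : Fin N) (x x' : ∀ j, Fin (n j) → ℝ) (w w' : ∀ j, U j) (t : ℝ),
      (∀ j, j ≠ i → x j = x' j) → (∀ j, j ≠ i → w j = w' j) →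
        c i x w t = c i x' w' t)
    (hs_indep : ∀ (i : Fin N) (x x' : ∀ j, Fin (n j) → ℝ),
      (∀ j, j ≠ i → x j = x' j) → s i x = s i x')
    (hp_int : ∀ u : ∀ j, ℝ → U j,
      IntegrableOn (fun t => p (fun j => ξ j (u j) t) (fun j => u j t) t)
        (Set.Icc 0 T))
    (hc_int : ∀ (i : Fin N) (u : ∀ j, ℝ → U j),
      IntegrableOn (fun t => c i (fun j => ξ j (u j) t) (fun j => u j t) t)
        (Set.Icc 0 T))
    (C : Fin N → (∀ j, ℝ → U j) → ℝ)
    (hC : ∀ (i : Fin N) (u : ∀ j, ℝ → U j),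
      C i u =
        (∫ t in Set.Icc 0 T,
          (p (fun j => ξ j (u j) t) (fun j => u j t) t +
            c i (fun j => ξ j (u j) t) (fun j => u j t) t)) +
        sbar (fun j => ξ j (u j) T) + s i (fun j => ξ j (u j) T))
    (ustar : ∀ j, ℝ → U j)
    (hmin : ∀ u : ∀ j, ℝ → U j,
      (∫ t in Set.Icc 0 T,
          p (fun j => ξ j (ustar j) t) (fun j => ustar j t) t) +
        sbar (fun j => ξ j (ustar j) T) ≤
      (∫ t in Set.Icc 0 T,
          p (fun j => ξ j (u j) t) (fun j => u j t) t) +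
        sbar (fun j => ξ j (u j) T)) :
    ∀ (i : Fin N) (v : ℝ → U i),
      C i ustar ≤ C i (Function.update ustar i v) := by
  intro i v
  have hother : ∀ j, j ≠ i → ustar j = Function.update ustar i v j :=
    fun j hj => (Function.update_of_ne hj v ustar).symm
  have hs := hs_indep i (fun j => ξ j (ustar j) T)
    (fun j => ξ j (Function.update ustar i v j) T)
    (fun j hj => by simp only [← hother j hj])
  have hc : (fun t => c i (fun j => ξ j (ustar j) t) (fun j => ustar j t) t) =
      fun t => c i (fun j => ξ j (Function.update ustar i v j) t)
        (fun j => Function.update ustar i v j t) t :=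
    funext fun t => hc_indep i _ _ _ _ t
      (fun j hj => by simp only [← hother j hj]) (fun j hj => by simp only [← hother j hj])
  rw [hC, hC, integral_add (hp_int _) (hc_int i _), integral_add (hp_int _) (hc_int i _), hc, hs]
  linarith [hmin (Function.update ustar i v)]
end

section
/- In the setting of N players over [0, T] with decoupled trajectory maps ξ_i, costs C_i(u) = ∫_0^T (p(x_u(t), u(t), t) + c_i(x_u(t), u(t), t)) dt + s̄(x_u(T)) + s_i(x_u(T)), where c_i is independent of the i-th components of its state and control arguments, s_i is independent of the i-th component of its state argument, and for every joint strategy u the functions t ↦ p(x_u(t), u(t), t) and t ↦ c_i(x_u(t), u(t), t) are integrable on [0, T]: the potential cost J(u) = ∫_0^T p(x_u(t), u(t), t) dt + s̄(x_u(T)) satisfies the exact-potential identity C_i(u[i ↦ v]) − C_i(u) = J(u[i ↦ v]) − J(u) for every player i, every joint strategy u, and every strategy v : [0, T] → U_i. -/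
open MeasureTheory

/-- Potential differential game (open-loop, decoupled dynamics): the potential
optimal control cost `J(u) = ∫₀ᵀ p dt + s̄(x(T))` is an exact potential for the
game with costs `Cᵢ(u) = ∫₀ᵀ (p + cᵢ) dt + s̄(x(T)) + sᵢ(x(T))`, where `cᵢ` and
`sᵢ` are independent of player `i`'s own state and control. -/
theorem potential_ocp_is_exact_potential
    {N : ℕ} (T : ℝ) (hT : 0 < T)
    (U : Fin N → Type*) (n : Fin N → ℕ)
    (ξ : ∀ i : Fin N, (ℝ → U i) → ℝ → (Fin (n i) → ℝ))
    (p : (∀ j, Fin (n j) → ℝ) → (∀ j, U j) → ℝ → ℝ)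
    (c : ∀ _ : Fin N, (∀ j, Fin (n j) → ℝ) → (∀ j, U j) → ℝ → ℝ)
    (sbar : (∀ j, Fin (n j) → ℝ) → ℝ)
    (s : ∀ _ : Fin N, (∀ j, Fin (n j) → ℝ) → ℝ)
    (hc_indep : ∀ (i : Fin N) (x x' : ∀ j, Fin (n j) → ℝ) (w w' : ∀ j, U j) (t : ℝ),
      (∀ j, j ≠ i → x j = x' j) → (∀ j, j ≠ i → w j = w' j) →
        c i x w t = c i x' w' t)
    (hs_indep : ∀ (i : Fin N) (x x' : ∀ j, Fin (n j) → ℝ),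
      (∀ j, j ≠ i → x j = x' j) → s i x = s i x')
    (hp_int : ∀ u : ∀ j, ℝ → U j,
      IntegrableOn (fun t => p (fun j => ξ j (u j) t) (fun j => u j t) t)
        (Set.Icc 0 T))
    (hc_int : ∀ (i : Fin N) (u : ∀ j, ℝ → U j),
      IntegrableOn (fun t => c i (fun j => ξ j (u j) t) (fun j => u j t) t)
        (Set.Icc 0 T))
    (C : Fin N → (∀ j, ℝ → U j) → ℝ)
    (hC : ∀ (i : Fin N) (u : ∀ j, ℝ → U j),
      C i u =
        (∫ t in Set.Icc 0 T,
          (p (fun j => ξ j (u j) t) (fun j => u j t) t +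
            c i (fun j => ξ j (u j) t) (fun j => u j t) t)) +
        sbar (fun j => ξ j (u j) T) + s i (fun j => ξ j (u j) T))
    (J : (∀ j, ℝ → U j) → ℝ)
    (hJ : ∀ u : ∀ j, ℝ → U j,
      J u =
        (∫ t in Set.Icc 0 T,
          p (fun j => ξ j (u j) t) (fun j => u j t) t) +
        sbar (fun j => ξ j (u j) T)) :
    ∀ (i : Fin N) (u : ∀ j, ℝ → U j) (v : ℝ → U i),
      C i (Function.update u i v) - C i u =
        J (Function.update u i v) - J u := by
  intro i u v
  have hstate : ∀ (t : ℝ) (j : Fin N), j ≠ i →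
      ξ j (Function.update u i v j) t = ξ j (u j) t := by
    intro t j hj
    rw [Function.update_of_ne hj]
  have hcontrol : ∀ (t : ℝ) (j : Fin N), j ≠ i →
      Function.update u i v j t = u j t := by
    intro t j hj
    rw [Function.update_of_ne hj]
  have hc : (fun t => c i (fun j => ξ j (Function.update u i v j) t)
        (fun j => Function.update u i v j t) t) =
      fun t => c i (fun j => ξ j (u j) t) (fun j => u j t) t :=
    funext fun t => hc_indep i _ _ _ _ t (hstate t) (hcontrol t)
  rw [hC, hC, hJ, hJ, integral_add (hp_int _) (hc_int i _),
    integral_add (hp_int _) (hc_int i _), hc, hs_indep i _ _ (hstate T)]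
  ring
end
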